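/- For every positive integer n, Σ over matrices A in PM_n of z^{rsum_1(A)} equals the coefficient of t^n in the polynomial Σ_{m=0}^{n} ∏_{i=1}^{m} ( 1 − (1−t)^{i−1}(1−zt) ), viewed as a polynomial in t with coefficients in ℤ[z]. Equivalently, writing a_{n,k} for the number of matrices A in PM_n with rsum_1(A) = k, one has Σ_{k} a_{n,k} z^k equal to that coefficient. -/

import Mathlib

open Polynomial

/-- A finite square matrix of natural numbers, of arbitrary dimension. -/
def SqMat : Type := Σ d : ℕ, Matrix (Fin d) (Fin d) ℕ

namespace SqMat

/-- The number of rows (= number of columns) of the matrix. -/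
def dim (A : SqMat) : ℕ := A.1

/-- The entry in row `r`, column `c` (0-indexed), and `0` out of range. -/
def ent (A : SqMat) (r c : ℕ) : ℕ :=
  if h : r < A.1 ∧ c < A.1 then A.2 ⟨r, h.1⟩ ⟨c, h.2⟩ else 0

/-- The sum of the entries of row `i` (0-indexed). -/
def rsum (A : SqMat) (i : ℕ) : ℕ := ∑ j ∈ Finset.range A.1, A.ent i j

/-- The sum of the entries of column `j` (0-indexed). -/
def csum (A : SqMat) (j : ℕ) : ℕ := ∑ i ∈ Finset.range A.1, A.ent i j

/-- The sum of all entries of the matrix. -/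
def total (A : SqMat) : ℕ := ∑ i ∈ Finset.range A.1, A.rsum i

/-- The least row index (0-indexed) at which column `j` has a nonzero entry. -/
noncomputable def colMin (A : SqMat) (j : ℕ) : ℕ := sInf {i : ℕ | A.ent i j ≠ 0}

/-- The matrix is upper triangular. -/
def UpperTri (A : SqMat) : Prop := ∀ r c : ℕ, c < r → A.ent r c = 0

/-- All entries are `0` or `1`. -/
def ZeroOne (A : SqMat) : Prop := ∀ r c : ℕ, A.ent r c ≤ 1

/-- Every column contains at least one nonzero entry. -/
def ColsNonzero (A : SqMat) : Prop := ∀ j < A.1, 0 < A.csum j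

/-- Every row contains at least one nonzero entry. -/
def RowsNonzero (A : SqMat) : Prop := ∀ i < A.1, 0 < A.rsum i

/-- Membership in `M_n`: upper triangular `(0,1)`-matrices with entries summing
to `n` in which every column contains at least one nonzero entry. -/
def MemM (n : ℕ) (A : SqMat) : Prop :=
  A.UpperTri ∧ A.ZeroOne ∧ A.total = n ∧ A.ColsNonzero

/-- Column `j` (0-indexed; so `j` corresponds to the 1-indexed column `j+1` of the paper)
is improper: either its column sum is at least `2`, or `j ≥ 1`, its column sum is `1`,
its row sum is `0`, and `min_j(A) < min_{j-1}(A)`. -/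
def ImproperCol (A : SqMat) (j : ℕ) : Prop :=
  2 ≤ A.csum j ∨
    (1 ≤ j ∧ A.csum j = 1 ∧ A.rsum j = 0 ∧ A.colMin j < A.colMin (j - 1))

/-- The matrix is proper: no column is improper. -/
def Proper (A : SqMat) : Prop := ∀ j < A.1, ¬ A.ImproperCol j

/-- Membership in `PM_n`: proper matrices of `M_n`. -/
def MemPM (n : ℕ) (A : SqMat) : Prop := MemM n A ∧ A.Proper

/-- Membership in `I_n`: upper triangular matrices with non-negative integer entries
summing to `n` in which every row and every column contains at least one nonzero entry. -/
def MemI (n : ℕ) (A : SqMat) : Prop :=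
  A.UpperTri ∧ A.total = n ∧ A.RowsNonzero ∧ A.ColsNonzero

end SqMat

/-- The weight `z` of a one in the first row, and `1` of a one elsewhere. -/
noncomputable def rowWeight (b : ℕ) : Polynomial ℤ := if b = 0 then X else 1

/-- The signed weight of a list of values placed from position `j` on, where `S` is the set of
values available so far and `a` is the preceding value. Each position either becomes available
itself, or is declared unavailable at the cost of a sign and of a descent. -/
noncomputable def signedWeight : ℕ → Finset ℕ → ℕ → List ℕ → Polynomial ℤ
  | _, _, _, [] => 1
  | j, S, a, b :: l =>
    (if b ∈ insert j S then rowWeight b * signedWeight (j + 1) (insert j S) b l else 0)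
      - (if b ∈ S ∧ b < a then rowWeight b * signedWeight (j + 1) S b l else 0)

/-- All values of the list are available when used, and every descent occurs at a position
that is a later value of the list. -/
def ProperFrom : ℕ → Finset ℕ → ℕ → List ℕ → Prop
  | _, _, _, [] => True
  | j, S, a, b :: l =>
    b ∈ insert j S ∧ ¬ (b < a ∧ j ∉ b :: l) ∧ ProperFrom (j + 1) (insert j S) b l

lemma properFrom_iff_insert {x : ℕ} (l : List ℕ) :
    ∀ (j : ℕ) (S : Finset ℕ) (a : ℕ), x ∉ S → x < j →
      (ProperFrom j S a l ↔ ProperFrom j (insert x S) a l ∧ x ∉ l) := by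
  induction l with
  | nil => simp [ProperFrom]
  | cons b l ih =>
    intro j S a hx hj
    have hx' : x ∉ insert j S := by simp [hx, hj.ne]
    simp only [ProperFrom, ih (j + 1) (insert j S) b hx' (by omega), Finset.insert_comm j x,
      List.mem_cons, Finset.mem_insert] at *
    by_cases hb : b = x
    · subst hb; tauto
    · have : ¬ x = b := fun h => hb h.symm
      tauto

open Classical in
lemma signedWeight_eq (l : List ℕ) :
    ∀ (j : ℕ) (S : Finset ℕ) (a : ℕ), (∀ x ∈ S, x < j) →
      signedWeight j S a l = if ProperFrom j S a l then (X : Polynomial ℤ) ^ l.count 0 else 0 := by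
  induction l with
  | nil => simp [signedWeight, ProperFrom]
  | cons b l ih =>
    intro j S a hS
    have hjS : j ∉ S := fun h => (hS j h).ne rfl
    have hS' : ∀ x ∈ insert j S, x < j + 1 := by
      intro x hx
      rcases Finset.mem_insert.1 hx with rfl | hx
      · omega
      · have := hS x hx; omega
    have hw : rowWeight b * (X : Polynomial ℤ) ^ l.count 0 = X ^ (b :: l).count 0 := by
      unfold rowWeight
      by_cases hb : b = 0
      · subst hb; simp [pow_succ']
      · simp [hb]
    have key := properFrom_iff_insert l (j + 1) S b hjS (by omega)
    rw [signedWeight, ih _ _ _ hS', ih _ _ _ (fun x hx => (hS x hx).trans (by omega))]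
    simp only [key, ProperFrom, List.mem_cons, mul_ite, hw, mul_zero]
    by_cases hP : ProperFrom (j + 1) (insert j S) b l
    · simp only [hP, Finset.mem_insert, true_and, if_true, and_true]
      by_cases hbj : b = j
      · subst hbj; simp [hjS]
      · have : ¬ j = b := fun h => hbj h.symm
        by_cases h1 : b ∈ S <;> by_cases h2 : b < a <;> by_cases h3 : j ∈ l <;>
          simp [h1, h2, h3, hbj, this]
    · simp [hP]

/-- The total signed weight of the continuations of length `r`, when `c` values are available
and `k` of them are smaller than the preceding value. -/
noncomputable def rankWeight : ℕ → ℕ → ℕ → Polynomial ℤ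
  | 0, _, _ => 1
  | r + 1, c, k =>
    (∑ b ∈ Finset.range (c + 1), rowWeight b * rankWeight r (c + 1) b)
      - ∑ b ∈ Finset.range k, rowWeight b * rankWeight r c b

lemma sum_card_filter_lt {M : Type*} [AddCommMonoid M] (T : Finset ℕ) (g : ℕ → M) :
    ∑ b ∈ T, g (T.filter (· < b)).card = ∑ i ∈ Finset.range T.card, g i := by
  induction T using Finset.induction_on_max with
  | empty => simp
  | insert a s hs ih =>
    have ha : a ∉ s := fun h => (hs a h).ne rfl
    rw [Finset.sum_insert ha, Finset.card_insert_of_notMem ha, Finset.sum_range_succ, ← ih,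
      add_comm]
    congr 1
    · refine Finset.sum_congr rfl fun b hb => ?_
      rw [Finset.filter_insert, if_neg (hs b hb).not_gt]
    · rw [Finset.filter_insert, if_neg (lt_irrefl a), Finset.filter_true_of_mem hs]

lemma rowWeight_card_filter_lt {T : Finset ℕ} {b : ℕ} (h0 : 0 ∈ T) :
    rowWeight (T.filter (· < b)).card = rowWeight b := by
  unfold rowWeight
  congr 1
  rw [Finset.card_eq_zero, Finset.filter_eq_empty_iff, eq_iff_iff]
  constructor
  · intro h
    have := h h0
    omega
  · rintro rfl; simp

lemma sum_fin_ite_mem {N : ℕ} {T : Finset ℕ} (hT : T ⊆ Finset.range N) (g : ℕ → Polynomial ℤ) :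
    ∑ b : Fin N, (if (b : ℕ) ∈ T then g b else 0) = ∑ b ∈ T, g b := by
  rw [Fin.sum_univ_eq_sum_range (fun b => if b ∈ T then g b else 0), ← Finset.sum_filter,
    Finset.filter_mem_eq_inter, Finset.inter_eq_right.2 hT]

lemma sum_signedWeight (N r : ℕ) :
    ∀ (j : ℕ) (S : Finset ℕ) (a : ℕ), S ⊆ Finset.range j → 0 ∈ insert j S → j + r ≤ N →
      ∑ f : Fin r → Fin N, signedWeight j S a (List.ofFn fun i => (f i : ℕ))
        = rankWeight r S.card (S.filter (· < a)).card := by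
  induction r with
  | zero => intros; simp [signedWeight, rankWeight]
  | succ r ih =>
    intro j S a hS h0 hN
    have hjS : j ∉ S := fun h => by simpa using hS h
    have hS' : insert j S ⊆ Finset.range (j + 1) := by
      intro x hx
      rcases Finset.mem_insert.1 hx with rfl | hx
      · simp
      · have := Finset.mem_range.1 (hS hx); simp; omega
    have hle {m : ℕ} {T : Finset ℕ} (hm : m ≤ N) (h : T ⊆ Finset.range m) :
        T ⊆ Finset.range N := h.trans (Finset.range_subset_range.2 hm)
    have h1 (b : ℕ) := ih (j + 1) (insert j S) b hS' (Finset.mem_insert_of_mem h0) (by omega)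
    rw [← (Fin.consEquiv fun _ => Fin N).sum_comp, Fintype.sum_prod_type]
    have hcons (b : Fin N) (f : Fin r → Fin N) :
        (List.ofFn fun i => ((Fin.consEquiv fun _ => Fin N) (b, f) i : ℕ))
          = (b : ℕ) :: List.ofFn fun i => (f i : ℕ) := by
      simp [List.ofFn_succ, Fin.consEquiv]
    simp only [hcons, signedWeight, Finset.sum_sub_distrib]
    rw [rankWeight]
    congr 1
    · have (b : Fin N) : ∑ f : Fin r → Fin N, (if (b : ℕ) ∈ insert j S then
          rowWeight b * signedWeight (j + 1) (insert j S) b (List.ofFn fun i => (f i : ℕ)) else 0)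
          = if (b : ℕ) ∈ insert j S then rowWeight b * rankWeight r (insert j S).card
            ((insert j S).filter (· < (b : ℕ))).card else 0 := by
        split_ifs
        · rw [← Finset.mul_sum, h1]
        · simp
      simp only [this]
      rw [sum_fin_ite_mem (hle (by omega) hS')
        (fun b => rowWeight b * rankWeight r (insert j S).card
          ((insert j S).filter (· < b)).card),
        ← Finset.card_insert_of_notMem hjS, ← sum_card_filter_lt]
      exact Finset.sum_congr rfl fun b _ => by rw [rowWeight_card_filter_lt h0]
    · rcases S.eq_empty_or_nonempty with rfl | ⟨x, hx⟩
      · simp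
      have h0S : 0 ∈ S := by
        rcases Finset.mem_insert.1 h0 with h | h
        · have := Finset.mem_range.1 (hS hx); omega
        · exact h
      have h2 (b : ℕ) := ih (j + 1) S b (hS.trans (Finset.range_subset_range.2 (by omega)))
        (Finset.mem_insert_of_mem h0S) (by omega)
      have (b : Fin N) : ∑ f : Fin r → Fin N, (if (b : ℕ) ∈ S ∧ (b : ℕ) < a then
          rowWeight b * signedWeight (j + 1) S b (List.ofFn fun i => (f i : ℕ)) else 0)
          = if (b : ℕ) ∈ S.filter (· < a) then rowWeight b * rankWeight r S.card
            (S.filter (· < (b : ℕ))).card else 0 := by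
        simp only [Finset.mem_filter]
        split_ifs
        · rw [← Finset.mul_sum, h2]
        · simp
      simp only [this]
      rw [sum_fin_ite_mem (hle (by omega : j ≤ N) ((Finset.filter_subset _ _).trans hS))
        (fun b => rowWeight b * rankWeight r S.card (S.filter (· < b)).card),
        ← sum_card_filter_lt]
      refine Finset.sum_congr rfl fun b hb => ?_
      have hba := (Finset.mem_filter.1 hb).2
      have : (S.filter (· < a)).filter (· < b) = S.filter (· < b) := by
        rw [Finset.filter_filter]
        exact Finset.filter_congr fun x _ => by omega
      rw [this, rowWeight_card_filter_lt h0S]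

/-- The generating function of `rankWeight` in the length. -/
noncomputable def rankSeries (c k : ℕ) : PowerSeries (Polynomial ℤ) :=
  PowerSeries.mk fun r => rankWeight r c k

lemma rankSeries_eq (c k : ℕ) :
    rankSeries c k = 1 + PowerSeries.X *
      ((∑ b ∈ Finset.range (c + 1), PowerSeries.C (rowWeight b) * rankSeries (c + 1) b)
        - ∑ b ∈ Finset.range k, PowerSeries.C (rowWeight b) * rankSeries c b) := by
  ext1 r
  cases r with
  | zero => simp [rankSeries, rankWeight]
  | succ r =>
    simp [rankSeries, rankWeight, PowerSeries.coeff_succ_X_mul, PowerSeries.coeff_one]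

lemma rankSeries_succ (c k : ℕ) :
    rankSeries c (k + 1)
      = (1 - PowerSeries.C (rowWeight k) * PowerSeries.X) * rankSeries c k := by
  have h1 := rankSeries_eq c (k + 1)
  have h2 := rankSeries_eq c k
  rw [Finset.sum_range_succ _ k] at h1
  linear_combination h1 - h2

lemma rankSeries_succ_eq_mul (c k : ℕ) :
    rankSeries c (k + 1)
      = (1 - PowerSeries.X) ^ k * (1 - PowerSeries.C X * PowerSeries.X) * rankSeries c 0 := by
  induction k with
  | zero => simp [rankSeries_succ, rowWeight]
  | succ k ih =>
    rw [rankSeries_succ, ih]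
    simp only [rowWeight, Nat.succ_ne_zero, if_false, map_one, one_mul]
    ring

lemma rankSeries_zero_right (c : ℕ) :
    rankSeries c 0 = 1 + (1 - (1 - PowerSeries.X) ^ c * (1 - PowerSeries.C X * PowerSeries.X))
      * rankSeries (c + 1) 0 := by
  have h1 := rankSeries_eq c 0
  have h2 := rankSeries_eq (c + 1) (c + 1)
  have h3 := rankSeries_eq (c + 1) 0
  have h4 := rankSeries_succ_eq_mul (c + 1) c
  simp only [Finset.range_zero, Finset.sum_empty] at h1 h3
  linear_combination h1 + h2 - h3 - h4

lemma rankSeries_zero_zero (M : ℕ) :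
    rankSeries 0 0 = (∑ m ∈ Finset.range M, ∏ i ∈ Finset.range m,
        ((1 : PowerSeries (Polynomial ℤ))
          - (1 - PowerSeries.X) ^ i * (1 - PowerSeries.C X * PowerSeries.X)))
      + (∏ i ∈ Finset.range M, ((1 : PowerSeries (Polynomial ℤ))
          - (1 - PowerSeries.X) ^ i * (1 - PowerSeries.C X * PowerSeries.X)))
        * rankSeries M 0 := by
  induction M with
  | zero => simp
  | succ M ih =>
    rw [Finset.sum_range_succ, Finset.prod_range_succ, ih]
    nth_rewrite 1 [rankSeries_zero_right M]
    ring

lemma rankWeight_zero_zero (n : ℕ) :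
    rankWeight n 0 0 = (∑ m ∈ Finset.range (n + 1), ∏ i ∈ Finset.range m,
        ((1 : Polynomial (Polynomial ℤ))
          - (1 - X) ^ i * (1 - C X * X))).coeff n := by
  have h : rankWeight n 0 0 = PowerSeries.coeff n (rankSeries 0 0) := by simp [rankSeries]
  have hdvd : PowerSeries.X ^ (n + 1) ∣ ∏ i ∈ Finset.range (n + 1),
      ((1 : PowerSeries (Polynomial ℤ))
        - (1 - PowerSeries.X) ^ i * (1 - PowerSeries.C X * PowerSeries.X)) := by
    have := Finset.prod_dvd_prod_of_dvd (s := Finset.range (n + 1))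
      (fun _ => (PowerSeries.X : PowerSeries (Polynomial ℤ)))
      (fun i => (1 : PowerSeries (Polynomial ℤ))
        - (1 - PowerSeries.X) ^ i * (1 - PowerSeries.C X * PowerSeries.X))
      (fun i _ => by rw [PowerSeries.X_dvd_iff]; simp)
    simpa using this
  rw [h, rankSeries_zero_zero (n + 1), map_add,
    PowerSeries.X_pow_dvd_iff.1 (hdvd.mul_right _) n (Nat.lt_succ_self n), add_zero,
    ← Polynomial.coeff_coe]
  congr 1
  rw [← Polynomial.coeToPowerSeries.ringHom_apply]
  simp [map_sum, map_prod, Polynomial.coeToPowerSeries.ringHom_apply]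

lemma properFrom_range_iff (l : List ℕ) :
    ∀ (j a : ℕ), ProperFrom j (Finset.range j) a l ↔
      ∀ i (hi : i < l.length), l[i] ≤ j + i ∧
        ¬ (l[i] < (a :: l)[i]'(by simp; omega) ∧
          ∀ k (hk : k < l.length), i ≤ k → l[k] ≠ j + i) := by
  induction l with
  | nil => simp [ProperFrom]
  | cons b l ih =>
    intro j a
    rw [ProperFrom, ← Finset.range_add_one, ih]
    constructor
    · rintro ⟨h1, h2, h3⟩ i hi
      rcases i with _ | i
      · refine ⟨by simpa [Nat.lt_succ_iff] using h1, fun ⟨h4, h5⟩ => h2 ⟨h4, fun h6 => ?_⟩⟩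
        obtain ⟨k, hk, h7⟩ := List.getElem_of_mem h6
        exact h5 k hk (Nat.zero_le _) h7
      · obtain ⟨h4, h5⟩ := h3 i (by simpa using hi)
        refine ⟨by simp; omega, fun ⟨h6, h7⟩ => h5 ⟨by simpa using h6, fun k hk hik => ?_⟩⟩
        have := h7 (k + 1) (by simpa using hk) (by omega)
        simp at this
        omega
    · intro h
      refine ⟨?_, ?_, fun i hi => ?_⟩
      · have := (h 0 (by simp)).1
        simp at this ⊢; omega
      · rintro ⟨h1, h2⟩
        refine (h 0 (by simp)).2 ⟨h1, fun k hk _ h3 => h2 ?_⟩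
        rw [add_zero] at h3
        rw [← h3]
        exact List.getElem_mem _
      · obtain ⟨h4, h5⟩ := h (i + 1) (by simpa using hi)
        refine ⟨by simp at h4; omega, fun ⟨h6, h7⟩ => h5 ⟨by simpa using h6, fun k hk hik => ?_⟩⟩
        obtain ⟨k, rfl⟩ : ∃ k', k = k' + 1 := ⟨k - 1, by omega⟩
        have := h7 k (by simpa using hk) (by omega)
        simp
        omega

namespace SqMat

/-- The matrix whose column `j` has a single one, in row `f j`. -/
def ofFun {n : ℕ} (f : Fin n → Fin n) : SqMat := ⟨n, fun i j => if f j = i then 1 else 0⟩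

lemma ofFun_fst {n : ℕ} (f : Fin n → Fin n) : (ofFun f).1 = n := rfl

lemma ofFun_injective (n : ℕ) : Function.Injective (ofFun (n := n)) := by
  intro f g h
  have h1 : (fun i j => if f j = i then 1 else 0 : Matrix (Fin n) (Fin n) ℕ)
      = fun i j => if g j = i then 1 else 0 := eq_of_heq (Sigma.mk.inj h).2
  funext j
  have h2 := congrFun (congrFun h1 (f j)) j
  by_contra h3
  simp [Ne.symm h3] at h2

lemma ent_ofFun {n : ℕ} (f : Fin n → Fin n) (i : ℕ) (j : Fin n) :
    (ofFun f).ent i j = if (f j : ℕ) = i then 1 else 0 := by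
  unfold ent
  split_ifs with h1 h2 h2
  · simp [ofFun, ← h2]
  · simp [ofFun, Fin.ext_iff, h2]
  · exact absurd ⟨h2 ▸ (f j).2, j.2⟩ h1
  · rfl

lemma csum_ofFun {n : ℕ} (f : Fin n → Fin n) (j : Fin n) : (ofFun f).csum j = 1 := by
  simp [csum, ent_ofFun, ofFun_fst]

lemma sum_ite_eq_count_ofFn {n : ℕ} (g : Fin n → ℕ) (i : ℕ) :
    ∑ j, (if g j = i then 1 else 0) = (List.ofFn g).count i := by
  induction n with
  | zero => simp
  | succ n ih =>
    rw [Fin.sum_univ_succ, ih, List.ofFn_succ, List.count_cons, add_comm]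
    simp

lemma rsum_ofFun {n : ℕ} (f : Fin n → Fin n) (i : ℕ) :
    (ofFun f).rsum i = (List.ofFn fun j => (f j : ℕ)).count i := by
  rw [rsum, ofFun_fst, ← Fin.sum_univ_eq_sum_range (fun j => (ofFun f).ent i j)]
  simp only [ent_ofFun]
  exact sum_ite_eq_count_ofFn (fun j => (f j : ℕ)) i

lemma colMin_ofFun {n : ℕ} (f : Fin n → Fin n) (j : Fin n) : (ofFun f).colMin j = f j := by
  have : {i : ℕ | (ofFun f).ent i j ≠ 0} = {(f j : ℕ)} := by
    ext i
    simp [ent_ofFun, eq_comm]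
  rw [colMin, this, csInf_singleton]

lemma ent_eq_zero_of_le {A : SqMat} {r c : ℕ} (h : A.1 ≤ c) : A.ent r c = 0 := by
  unfold ent
  rw [dif_neg]
  omega

lemma total_eq_sum_csum (A : SqMat) : A.total = ∑ j ∈ Finset.range A.1, A.csum j :=
  Finset.sum_comm

lemma memPM_ofFun_iff {n : ℕ} (f : Fin n → Fin n) :
    MemPM n (ofFun f) ↔ ProperFrom 0 ∅ 0 (List.ofFn fun j => (f j : ℕ)) := by
  have hU : (ofFun f).UpperTri ↔ ∀ j : Fin n, f j ≤ j := by
    constructor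
    · intro h j
      by_contra hlt
      have := h (f j) j (by simpa using hlt)
      simp [ent_ofFun] at this
    · intro h r c hrc
      by_cases hc : c < n
      · have := ent_ofFun f r ⟨c, hc⟩
        have h2 := h ⟨c, hc⟩
        simp only [Fin.le_def] at h2
        rw [if_neg (by omega)] at this
        exact this
      · exact ent_eq_zero_of_le (by rw [ofFun_fst]; omega)
  have hZ : (ofFun f).ZeroOne := by
    intro r c
    by_cases hc : c < n
    · have := ent_ofFun f r ⟨c, hc⟩
      simp only at this
      rw [this]; split_ifs <;> simp
    · rw [ent_eq_zero_of_le (by rw [ofFun_fst]; omega)]; simp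
  have hT : (ofFun f).total = n := by
    rw [total_eq_sum_csum, ofFun_fst, ← Fin.sum_univ_eq_sum_range]
    simp [csum_ofFun]
  have hC : (ofFun f).ColsNonzero := fun j hj => by
    rw [csum_ofFun f ⟨j, hj⟩]; exact one_pos
  have hP : (ofFun f).Proper ↔ ∀ (j : ℕ) (hj : j + 1 < n),
      ¬ ((∀ k, (f k : ℕ) ≠ j + 1) ∧ f ⟨j + 1, hj⟩ < f ⟨j, by omega⟩) := by
    have hI (j : ℕ) (hj : j + 1 < n) : (ofFun f).ImproperCol (j + 1) ↔
        ((∀ k, (f k : ℕ) ≠ j + 1) ∧ f ⟨j + 1, hj⟩ < f ⟨j, by omega⟩) := by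
      have h1 := csum_ofFun f ⟨j + 1, hj⟩
      have h2 := colMin_ofFun f ⟨j + 1, hj⟩
      have h3 := colMin_ofFun f ⟨j, by omega⟩
      simp only at h1 h2 h3
      simp [ImproperCol, h1, h2, h3, rsum_ofFun, List.count_eq_zero]
    constructor
    · intro h j hj
      rw [← hI j hj]
      exact h (j + 1) hj
    · intro h j hj
      rcases j with _ | j
      · have h1 := csum_ofFun f ⟨0, hj⟩
        simp only at h1
        simp [ImproperCol, h1]
      · rw [hI j hj]
        exact h j hj
  have hR := properFrom_range_iff (List.ofFn fun j => (f j : ℕ)) 0 0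
  rw [Finset.range_zero] at hR
  rw [hR, MemPM, MemM, hU, hP]
  simp only [hZ, hT, hC, and_true, List.getElem_ofFn, zero_add, List.length_ofFn]
  constructor
  · rintro ⟨h1, h2⟩ i hi
    refine ⟨h1 ⟨i, hi⟩, ?_⟩
    rcases i with _ | i
    · simp
    · rintro ⟨h3, h4⟩
      refine h2 i hi ⟨fun k hk => ?_, by simpa using h3⟩
      by_cases hik : i + 1 ≤ k
      · exact h4 k k.2 hik hk
      · have := h1 k
        simp only [Fin.le_def] at this
        omega
  · intro h
    refine ⟨fun j => (h j j.2).1, fun j hj ⟨h1, h2⟩ => ?_⟩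
    exact (h (j + 1) hj).2 ⟨by simpa using h2, fun k hk _ => h1 ⟨k, hk⟩⟩

lemma exists_eq_ofFun {n : ℕ} {A : SqMat} (hA : MemPM n A) :
    ∃ f : Fin n → Fin n, ofFun f = A := by
  obtain ⟨⟨-, hZ, hT, hC⟩, hP⟩ := hA
  have h1 : ∀ j < A.1, A.csum j = 1 := fun j hj => by
    have := hC j hj
    have : ¬ 2 ≤ A.csum j := fun h => hP j hj (Or.inl h)
    omega
  have hn : A.1 = n := by
    rw [← hT, total_eq_sum_csum, Finset.sum_congr rfl fun j hj => h1 j (Finset.mem_range.1 hj)]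
    simp
  obtain ⟨d, M⟩ := A
  change d = n at hn
  subst hn
  have hent (i j : Fin d) : ent ⟨d, M⟩ i j = M i j := by simp [ent]
  have hsum (j : Fin d) : ∑ i, M i j = 1 := by
    rw [← h1 j j.2]
    unfold csum
    rw [← Fin.sum_univ_eq_sum_range (fun i => ent ⟨d, M⟩ i j)]
    simp only [hent]
  have hex (j : Fin d) : ∃ i, M i j ≠ 0 := by
    by_contra! h
    simpa [h] using hsum j
  choose f hf using hex
  refine ⟨f, ?_⟩
  unfold ofFun
  congr 1
  funext i j
  have h2 : M (f j) j = 1 := by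
    have := hZ (f j) j
    rw [hent] at this
    have := hf j
    omega
  split_ifs with h
  · rw [← h, h2]
  · have h3 := hsum j
    rw [← Finset.add_sum_erase _ _ (Finset.mem_univ (f j)), h2, Nat.add_eq_left,
      Finset.sum_eq_zero_iff] at h3
    exact (h3 i (by simp [Ne.symm h])).symm

lemma setOf_memPM_eq_image (n : ℕ) :
    {A : SqMat | MemPM n A} = ofFun ''
      {f : Fin n → Fin n | ProperFrom 0 ∅ 0 (List.ofFn fun j => (f j : ℕ))} := by
  ext A
  constructor
  · intro hA
    obtain ⟨f, rfl⟩ := exists_eq_ofFun hA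
    exact ⟨f, (memPM_ofFun_iff f).1 hA, rfl⟩
  · rintro ⟨f, hf, rfl⟩
    exact (memPM_ofFun_iff f).2 hf

end SqMat

/-- For every positive integer `n`, the weight `Σ_{A ∈ PM_n} z^{rsum_1 A}`
equals the coefficient of `t^n` in the polynomial
`Σ_{m=0}^{n} ∏_{i=1}^{m} (1 - (1-t)^{i-1}(1-zt))`.
On the left, `X : Polynomial ℤ` plays the role of `z`; on the right, the outer variable
`X : Polynomial (Polynomial ℤ)` plays the role of `t` and `C X` the role of `z`, and the
product index `i ∈ Finset.range m` corresponds to the paper's `i+1`, so `(1-t)^{i-1}`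
becomes `(1 - X)^i`. -/
theorem weight_proper_eq_coeff (n : ℕ) (hn : 0 < n) :
    (∑ᶠ A ∈ {A : SqMat | SqMat.MemPM n A}, (X : Polynomial ℤ) ^ A.rsum 0)
    = (∑ m ∈ Finset.range (n + 1), ∏ i ∈ Finset.range m,
        ((1 : Polynomial (Polynomial ℤ))
          - (1 - X) ^ i * (1 - C X * X))).coeff n := by
  classical
  rw [SqMat.setOf_memPM_eq_image,
    finsum_mem_image ((SqMat.ofFun_injective n).injOn), ← rankWeight_zero_zero,
    finsum_mem_eq_finite_toFinset_sum _ (Set.toFinite _)]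
  have h := sum_signedWeight n n 0 ∅ 0 (by simp) (by simp) (by simp)
  simp only [Finset.card_empty, Finset.filter_empty] at h
  rw [← h]
  simp only [signedWeight_eq _ 0 ∅ 0 (by simp), ← Finset.sum_filter]
  refine Finset.sum_congr (by ext f; simp) fun f _ => by rw [SqMat.rsum_ofFun]
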